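/- arXiv:0802.3360 — 10 statements merged into one kernel-verified Lean document; each statement's English description precedes it below -/
import Mathlib

section
/- The bracket {·,·} makes V_ω into a Lie algebra: V_ω is a k-linear subspace of V closed under {·,·}, the bracket is bilinear and alternating, and it satisfies the Jacobi identity. Moreover V^𝔥 ⊆ V_ω and every element of V^𝔥 is central for this bracket: {v,w} = 0 whenever v ∈ V^𝔥 and w ∈ V_ω. -/
/-!  Abstract hamiltonian setting: basic definitions.

`V` is an `𝔥`-module via the bilinear map `act`.  For `v : V`, the
1-cochain `d_𝔥 v` is the map `ξ ↦ act ξ v`, and for `ω` a 2-cochain,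
`i_ξ ω = ω ξ`.  -/

variable {k : Type*} [Field k] [CharZero k]
variable {H : Type*} [LieRing H] [LieAlgebra k H]
variable {V : Type*} [AddCommGroup V] [Module k V]

/-- The Lie derivative `(L_ξ ω)(η, ζ)` of a 2-cochain `ω`. -/
def lieD (act : H →ₗ[k] V →ₗ[k] V) (ω : H →ₗ[k] H →ₗ[k] V) (ξ η ζ : H) : V :=
  act ξ (ω η ζ) - ω ⁅ξ, η⁆ ζ - ω η ⁅ξ, ζ⁆

/-- The Chevalley–Eilenberg differential `(d_𝔥 ω)(ξ₁,ξ₂,ξ₃)` of a 2-cochain. -/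
def d2 (act : H →ₗ[k] V →ₗ[k] V) (ω : H →ₗ[k] H →ₗ[k] V) (ξ₁ ξ₂ ξ₃ : H) : V :=
  act ξ₁ (ω ξ₂ ξ₃) - act ξ₂ (ω ξ₁ ξ₃) + act ξ₃ (ω ξ₁ ξ₂)
    - ω ⁅ξ₁, ξ₂⁆ ξ₃ + ω ⁅ξ₁, ξ₃⁆ ξ₂ - ω ⁅ξ₂, ξ₃⁆ ξ₁

/-- The Chevalley–Eilenberg differential `(d_𝔥 α)(ξ,η)` of a 1-cochain. -/
def d1 (act : H →ₗ[k] V →ₗ[k] V) (α : H →ₗ[k] V) (ξ η : H) : V :=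
  act ξ (α η) - act η (α ξ) - α ⁅ξ, η⁆

/-- The symplectic elements `sp(𝔥,ω) = {ξ : L_ξ ω = 0 ∧ i_ξ (d_𝔥 ω) = 0}`. -/
def spSet (act : H →ₗ[k] V →ₗ[k] V) (ω : H →ₗ[k] H →ₗ[k] V) : Set H :=
  {ξ | (∀ η ζ, lieD act ω ξ η ζ = 0) ∧ ∀ η ζ, d2 act ω ξ η ζ = 0}

/-- The hamiltonian elements `ham(𝔥,ω) = {ξ ∈ sp(𝔥,ω) : ∃ v, i_ξ ω = d_𝔥 v}`. -/
def hamSet (act : H →ₗ[k] V →ₗ[k] V) (ω : H →ₗ[k] H →ₗ[k] V) : Set H :=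
  {ξ | ξ ∈ spSet act ω ∧ ∃ v : V, ∀ η, ω ξ η = act η v}

/-- The admissible vectors `V_ω = {v : ∃ ξ ∈ ham(𝔥,ω), d_𝔥 v = i_ξ ω}`. -/
def admSet (act : H →ₗ[k] V →ₗ[k] V) (ω : H →ₗ[k] H →ₗ[k] V) : Set V :=
  {v | ∃ ξ ∈ hamSet act ω, ∀ η, act η v = ω ξ η}

/-- The radical `rad(ω, d_𝔥 ω) = {ξ : i_ξ ω = 0 ∧ i_ξ (d_𝔥 ω) = 0}`. -/
def radSet (act : H →ₗ[k] V →ₗ[k] V) (ω : H →ₗ[k] H →ₗ[k] V) : Set H :=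
  {ξ | (∀ η, ω ξ η = 0) ∧ ∀ η ζ, d2 act ω ξ η ζ = 0}

/-- The invariant vectors `V^𝔥 = {v : ∀ ξ, ξ · v = 0}`. -/
def invSet (act : H →ₗ[k] V →ₗ[k] V) : Set V := {v | ∀ ξ, act ξ v = 0}

theorem aux_d2 (act : H →ₗ[k] V →ₗ[k] V)
    (hact : ∀ (ξ η : H) (v : V), act ⁅ξ, η⁆ v = act ξ (act η v) - act η (act ξ v))
    (ω : H →ₗ[k] H →ₗ[k] V) (ξ : H)
    (hL : ∀ η ζ, act ξ (ω η ζ) = ω ⁅ξ, η⁆ ζ + ω η ⁅ξ, ζ⁆) (a b c : H) :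
    d2 act ω ⁅ξ, a⁆ b c = act ξ (d2 act ω a b c) - d2 act ω a ⁅ξ, b⁆ c
      - d2 act ω a b ⁅ξ, c⁆ := by
  have h : ∀ (x y z : H), act ξ (act x (ω y z))
      = act ⁅ξ, x⁆ (ω y z) + act x (ω ⁅ξ, y⁆ z) + act x (ω y ⁅ξ, z⁆) := by
    intro x y z
    have h1 := hact ξ x (ω y z)
    rw [hL y z, map_add] at h1
    rw [h1]; abel
  have h2 : ∀ (x y z : H), ω ⁅ξ, ⁅x, y⁆⁆ z = ω ⁅⁅ξ, x⁆, y⁆ z + ω ⁅x, ⁅ξ, y⁆⁆ z := by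
    intro x y z
    rw [leibniz_lie ξ x y, map_add, LinearMap.add_apply]
  simp only [d2, map_add, map_sub, h, hL, h2]
  abel

theorem aux_hamvec (act : H →ₗ[k] V →ₗ[k] V)
    (hact : ∀ (ξ η : H) (v : V), act ⁅ξ, η⁆ v = act ξ (act η v) - act η (act ξ v))
    (ω : H →ₗ[k] H →ₗ[k] V) (ξ₁ ξ₂ : H) (v₂ : V)
    (hL : ∀ η ζ, act ξ₁ (ω η ζ) = ω ⁅ξ₁, η⁆ ζ + ω η ⁅ξ₁, ζ⁆)
    (h2 : ∀ η, act η v₂ = ω ξ₂ η) (η : H) :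
    act η (ω ξ₂ ξ₁) = ω ⁅ξ₁, ξ₂⁆ η := by
  have e := hL ξ₂ η
  rw [← h2 ⁅ξ₁, η⁆, hact, h2 η, h2 ξ₁] at e
  have e' : ω ⁅ξ₁, ξ₂⁆ η - act η (ω ξ₂ ξ₁) = 0 := by
    have := sub_eq_zero.mpr e.symm
    rw [← this]; abel
  exact (sub_eq_zero.mp e').symm

theorem aux_L {act : H →ₗ[k] V →ₗ[k] V} {ω : H →ₗ[k] H →ₗ[k] V} {ξ : H}
    (h : ξ ∈ spSet act ω) (η ζ : H) : act ξ (ω η ζ) = ω ⁅ξ, η⁆ ζ + ω η ⁅ξ, ζ⁆ := by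
  have := h.1 η ζ
  unfold lieD at this
  rw [sub_sub] at this
  exact sub_eq_zero.mp this

theorem aux_sp_lie (act : H →ₗ[k] V →ₗ[k] V)
    (hact : ∀ (ξ η : H) (v : V), act ⁅ξ, η⁆ v = act ξ (act η v) - act η (act ξ v))
    (ω : H →ₗ[k] H →ₗ[k] V) {ξ₁ ξ₂ : H}
    (h₁ : ξ₁ ∈ spSet act ω) (h₂ : ξ₂ ∈ spSet act ω) : ⁅ξ₁, ξ₂⁆ ∈ spSet act ω := by
  refine ⟨fun η ζ => ?_, fun η ζ => ?_⟩
  · simp only [lieD, hact, aux_L h₁, aux_L h₂, map_add, lie_lie, map_sub, LinearMap.sub_apply]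
    abel
  · rw [aux_d2 act hact ω ξ₁ (aux_L h₁), h₂.2, h₂.2, h₂.2]
    simp

theorem aux_sp_add (act : H →ₗ[k] V →ₗ[k] V) (ω : H →ₗ[k] H →ₗ[k] V) {ξ₁ ξ₂ : H}
    (h₁ : ξ₁ ∈ spSet act ω) (h₂ : ξ₂ ∈ spSet act ω) : ξ₁ + ξ₂ ∈ spSet act ω := by
  refine ⟨fun η ζ => ?_, fun η ζ => ?_⟩
  · have : lieD act ω (ξ₁ + ξ₂) η ζ = lieD act ω ξ₁ η ζ + lieD act ω ξ₂ η ζ := by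
      simp only [lieD, map_add, LinearMap.add_apply, add_lie]; abel
    rw [this, h₁.1, h₂.1, add_zero]
  · have : d2 act ω (ξ₁ + ξ₂) η ζ = d2 act ω ξ₁ η ζ + d2 act ω ξ₂ η ζ := by
      simp only [d2, map_add, LinearMap.add_apply, add_lie]; abel
    rw [this, h₁.2, h₂.2, add_zero]

theorem aux_sp_smul (act : H →ₗ[k] V →ₗ[k] V) (ω : H →ₗ[k] H →ₗ[k] V) (a : k) {ξ : H}
    (h : ξ ∈ spSet act ω) : a • ξ ∈ spSet act ω := by
  refine ⟨fun η ζ => ?_, fun η ζ => ?_⟩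
  · have : lieD act ω (a • ξ) η ζ = a • lieD act ω ξ η ζ := by
      simp only [lieD, map_smul, LinearMap.smul_apply, smul_lie, smul_sub]
    rw [this, h.1, smul_zero]
  · have : d2 act ω (a • ξ) η ζ = a • d2 act ω ξ η ζ := by
      simp only [d2, map_smul, LinearMap.smul_apply, smul_lie, smul_sub, smul_add]
    rw [this, h.2, smul_zero]

/-- The bracket `{v₁,v₂} := ω(ξ₂,ξ₁)` makes `V_ω` into a Lie
algebra in which `V^𝔥` is central. -/
theorem statement4
    (act : H →ₗ[k] V →ₗ[k] V)
    (hact : ∀ (ξ η : H) (v : V), act ⁅ξ, η⁆ v = act ξ (act η v) - act η (act ξ v))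
    (ω : H →ₗ[k] H →ₗ[k] V) (hωalt : ∀ ξ, ω ξ ξ = 0)
    (br : V → V → V)
    (hbr : ∀ (v₁ v₂ : V) (ξ₁ ξ₂ : H), ξ₁ ∈ hamSet act ω → ξ₂ ∈ hamSet act ω →
      (∀ η, act η v₁ = ω ξ₁ η) → (∀ η, act η v₂ = ω ξ₂ η) → br v₁ v₂ = ω ξ₂ ξ₁) :
    (0 : V) ∈ admSet act ω ∧
    (∀ v w, v ∈ admSet act ω → w ∈ admSet act ω → v + w ∈ admSet act ω) ∧
    (∀ (a : k) (v : V), v ∈ admSet act ω → a • v ∈ admSet act ω) ∧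
    (∀ v w, v ∈ admSet act ω → w ∈ admSet act ω → br v w ∈ admSet act ω) ∧
    (∀ v₁ v₂ w, v₁ ∈ admSet act ω → v₂ ∈ admSet act ω → w ∈ admSet act ω →
      br (v₁ + v₂) w = br v₁ w + br v₂ w ∧ br w (v₁ + v₂) = br w v₁ + br w v₂) ∧
    (∀ (a : k) (v w : V), v ∈ admSet act ω → w ∈ admSet act ω →
      br (a • v) w = a • br v w ∧ br v (a • w) = a • br v w) ∧
    (∀ v, v ∈ admSet act ω → br v v = 0) ∧
    (∀ v₁ v₂ v₃, v₁ ∈ admSet act ω → v₂ ∈ admSet act ω → v₃ ∈ admSet act ω →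
      br (br v₁ v₂) v₃ + br (br v₂ v₃) v₁ + br (br v₃ v₁) v₂ = 0) ∧
    invSet act ⊆ admSet act ω ∧
    (∀ v w, v ∈ invSet act → w ∈ admSet act ω → br v w = 0) := by
  have hsk : ∀ x y, ω x y = - ω y x := by
    intro x y
    have := hωalt (x + y)
    simp only [map_add, LinearMap.add_apply, hωalt, zero_add, add_zero] at this
    exact eq_neg_of_add_eq_zero_right this
  have hham : ∀ (v : V) (ξ : H), ξ ∈ spSet act ω → (∀ η, act η v = ω ξ η) → ξ ∈ hamSet act ω :=
    fun v ξ h h' => ⟨h, v, fun η => (h' η).symm⟩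
  have hz : (0 : H) ∈ spSet act ω :=
    ⟨fun η ζ => by simp [lieD], fun η ζ => by simp [d2]⟩
  have Badd : ∀ (v w : V) (ξ η : H), (∀ x, act x v = ω ξ x) → (∀ x, act x w = ω η x) →
      ∀ x, act x (v + w) = ω (ξ + η) x := by
    intro v w ξ η h h' x
    simp [h, h']
  have Bsmul : ∀ (a : k) (v : V) (ξ : H), (∀ x, act x v = ω ξ x) →
      ∀ x, act x (a • v) = ω (a • ξ) x := by
    intro a v ξ h x
    simp [h]
  have hinv : ∀ v ∈ invSet act, ∀ x, act x v = ω 0 x := by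
    intro v hv x
    rw [hv x]; simp
  -- the bracket with its hamiltonian element
  have Bbr : ∀ (v w : V) (ξ η : H), ξ ∈ hamSet act ω → η ∈ hamSet act ω →
      (∀ x, act x v = ω ξ x) → (∀ x, act x w = ω η x) →
      ⁅ξ, η⁆ ∈ hamSet act ω ∧ ∀ x, act x (br v w) = ω ⁅ξ, η⁆ x := by
    intro v w ξ η hξ hη h h'
    have key : ∀ x, act x (br v w) = ω ⁅ξ, η⁆ x := by
      intro x
      rw [hbr v w ξ η hξ hη h h']
      exact aux_hamvec act hact ω ξ η w (aux_L hξ.1) h' x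
    exact ⟨hham _ _ (aux_sp_lie act hact ω hξ.1 hη.1) key, key⟩
  have Hadd : ∀ (v w : V) (ξ η : H), ξ ∈ hamSet act ω → η ∈ hamSet act ω →
      (∀ x, act x v = ω ξ x) → (∀ x, act x w = ω η x) → ξ + η ∈ hamSet act ω :=
    fun v w ξ η hξ hη h h' =>
      hham _ _ (aux_sp_add act ω hξ.1 hη.1) (Badd v w ξ η h h')
  have Hsmul : ∀ (a : k) (v : V) (ξ : H), ξ ∈ hamSet act ω →
      (∀ x, act x v = ω ξ x) → a • ξ ∈ hamSet act ω :=
    fun a v ξ hξ h => hham _ _ (aux_sp_smul act ω a hξ.1) (Bsmul a v ξ h)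
  have hinvH : (0 : H) ∈ hamSet act ω := ⟨hz, 0, fun η => by simp⟩
  refine ⟨⟨0, hinvH, fun η => by simp⟩, ?_, ?_, ?_, ?_, ?_, ?_, ?_, ?_, ?_⟩
  · rintro v w ⟨ξ, hξ, h⟩ ⟨η, hη, h'⟩
    exact ⟨ξ + η, Hadd v w ξ η hξ hη h h', Badd v w ξ η h h'⟩
  · rintro a v ⟨ξ, hξ, h⟩
    exact ⟨a • ξ, Hsmul a v ξ hξ h, Bsmul a v ξ h⟩
  · rintro v w ⟨ξ, hξ, h⟩ ⟨η, hη, h'⟩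
    exact ⟨⁅ξ, η⁆, Bbr v w ξ η hξ hη h h'⟩
  · rintro v₁ v₂ w ⟨ξ, hξ, h⟩ ⟨η, hη, h'⟩ ⟨ζ, hζ, h''⟩
    have H1 := Hadd v₁ v₂ ξ η hξ hη h h'
    have H2 := Badd v₁ v₂ ξ η h h'
    rw [hbr _ _ _ _ H1 hζ H2 h'', hbr _ _ _ _ hζ H1 h'' H2, hbr _ _ _ _ hξ hζ h h'',
      hbr _ _ _ _ hη hζ h' h'', hbr _ _ _ _ hζ hξ h'' h, hbr _ _ _ _ hζ hη h'' h']
    simp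
  · rintro a v w ⟨ξ, hξ, h⟩ ⟨η, hη, h'⟩
    rw [hbr _ _ _ _ (Hsmul a v ξ hξ h) hη (Bsmul a v ξ h) h',
      hbr _ _ _ _ hξ (Hsmul a w η hη h') h (Bsmul a w η h'), hbr _ _ _ _ hξ hη h h']
    simp
  · rintro v ⟨ξ, hξ, h⟩
    rw [hbr _ _ _ _ hξ hξ h h, hωalt]
  · rintro v₁ v₂ v₃ ⟨x, hx, h1⟩ ⟨y, hy, h2⟩ ⟨z, hz, h3⟩
    obtain ⟨a, a'⟩ := Bbr _ _ _ _ hx hy h1 h2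
    obtain ⟨b, b'⟩ := Bbr _ _ _ _ hy hz h2 h3
    obtain ⟨c, c'⟩ := Bbr _ _ _ _ hz hx h3 h1
    rw [hbr _ _ _ _ a hz a' h3, hbr _ _ _ _ b hx b' h1, hbr _ _ _ _ c hy c' h2]
    have e := aux_L hx.1 y z
    rw [aux_hamvec act hact ω z y v₂ (aux_L hz.1) h2 x, ← lie_skew z y, ← lie_skew x z,
      hsk _ x, hsk _ z] at e
    simp only [map_neg, neg_neg] at e
    rw [← sub_eq_zero] at e
    rw [← e]; abel
  · intro v hv
    exact ⟨0, hinvH, hinv v hv⟩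
  · rintro v w hv ⟨η, hη, h'⟩
    rw [hbr _ _ _ _ hinvH hη (hinv v hv) h', map_zero]
end

section
/- The linear map q : ham(𝔥,ω) → Hom(𝔥,V), q(ξ) := i_ξω, has image exactly d_𝔥(V_ω) := {d_𝔥v : v ∈ V_ω} and kernel rad(ω,d_𝔥ω); moreover, if ξ₁,ξ₂ ∈ ham(𝔥,ω) and v₁,v₂ ∈ V satisfy d_𝔥v₁ = i_{ξ₁}ω and d_𝔥v₂ = i_{ξ₂}ω, then i_{[ξ₁,ξ₂]}ω = d_𝔥({v₁,v₂}). In particular, 0 → rad(ω,d_𝔥ω) → ham(𝔥,ω) → d_𝔥(V_ω) → 0 is an exact sequence, rad(ω,d_𝔥ω) is an ideal of ham(𝔥,ω), and q intertwines the Lie bracket of ham(𝔥,ω) with the bracket induced by {·,·} on d_𝔥(V_ω). -/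
/-!  Abstract hamiltonian setting: basic definitions.

`V` is an `𝔥`-module via the bilinear map `act`.  For `v : V`, the
1-cochain `d_𝔥 v` is the map `ξ ↦ act ξ v`, and for `ω` a 2-cochain,
`i_ξ ω = ω ξ`.  -/

variable {k : Type*} [Field k] [CharZero k]
variable {H : Type*} [LieRing H] [LieAlgebra k H]
variable {V : Type*} [AddCommGroup V] [Module k V]

theorem aux_skew (ω : H →ₗ[k] H →ₗ[k] V) (hωalt : ∀ ξ, ω ξ ξ = 0) (a b : H) :
    ω a b = - ω b a := by
  have h := hωalt (a + b)
  simp only [map_add, LinearMap.add_apply, hωalt, zero_add, add_zero] at h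
  rw [add_comm] at h
  exact eq_neg_of_add_eq_zero_left h

theorem aux_cartan (act : H →ₗ[k] V →ₗ[k] V) (ω : H →ₗ[k] H →ₗ[k] V)
    (hωalt : ∀ ξ, ω ξ ξ = 0) (a b c : H) :
    d2 act ω a b c = lieD act ω a b c - d1 act (ω a) b c := by
  unfold d2 lieD d1
  rw [aux_skew ω hωalt ⁅a, c⁆ b, aux_skew ω hωalt ⁅b, c⁆ a]
  abel

theorem aux_lie (act : H →ₗ[k] V →ₗ[k] V)
    (hact : ∀ (ξ η : H) (v : V), act ⁅ξ, η⁆ v = act ξ (act η v) - act η (act ξ v))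
    (ω : H →ₗ[k] H →ₗ[k] V) (x y : H)
    (hx : ∀ a b, lieD act ω x a b = 0) (hy : ∀ a b, lieD act ω y a b = 0) (a b : H) :
    lieD act ω ⁅x, y⁆ a b = 0 := by
  have hx' : ∀ a b, act x (ω a b) = ω ⁅x, a⁆ b + ω a ⁅x, b⁆ := fun a b => by
    have := hx a b
    unfold lieD at this
    rw [sub_sub, sub_eq_zero] at this
    exact this
  have hy' : ∀ a b, act y (ω a b) = ω ⁅y, a⁆ b + ω a ⁅y, b⁆ := fun a b => by
    have := hy a b
    unfold lieD at this
    rw [sub_sub, sub_eq_zero] at this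
    exact this
  unfold lieD
  simp only [hact, hx', hy', map_add, lie_lie, map_sub, LinearMap.sub_apply]
  abel

/-- The map `q : ham(𝔥,ω) → Hom(𝔥,V)`, `q(ξ) = i_ξ ω`, has
image `d_𝔥(V_ω)`, kernel `rad(ω,d_𝔥ω)`, and intertwines the Lie brackets:
`i_{[ξ₁,ξ₂]} ω = d_𝔥({v₁,v₂})` with `{v₁,v₂} = ω(ξ₂,ξ₁)`. -/
theorem statement5
    (act : H →ₗ[k] V →ₗ[k] V)
    (hact : ∀ (ξ η : H) (v : V), act ⁅ξ, η⁆ v = act ξ (act η v) - act η (act ξ v))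
    (ω : H →ₗ[k] H →ₗ[k] V) (hωalt : ∀ ξ, ω ξ ξ = 0) :
    -- the image of q is exactly d_𝔥(V_ω)
    (∀ ξ, ξ ∈ hamSet act ω → ∃ v ∈ admSet act ω, ∀ η, ω ξ η = act η v) ∧
    (∀ v, v ∈ admSet act ω → ∃ ξ ∈ hamSet act ω, ∀ η, act η v = ω ξ η) ∧
    -- the kernel of q on ham(𝔥,ω) is the radical
    (∀ ξ, ξ ∈ radSet act ω ↔ ξ ∈ hamSet act ω ∧ ∀ η, ω ξ η = 0) ∧
    -- the radical is an ideal of ham(𝔥,ω)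
    (∀ ξ ρ, ξ ∈ hamSet act ω → ρ ∈ radSet act ω → ⁅ξ, ρ⁆ ∈ radSet act ω) ∧
    -- q intertwines brackets:  i_{[ξ₁,ξ₂]} ω = d_𝔥 (ω(ξ₂,ξ₁)) = d_𝔥 {v₁,v₂}
    (∀ (ξ₁ ξ₂ : H) (v₁ v₂ : V), ξ₁ ∈ hamSet act ω → ξ₂ ∈ hamSet act ω →
      (∀ η, act η v₁ = ω ξ₁ η) → (∀ η, act η v₂ = ω ξ₂ η) →
      ⁅ξ₁, ξ₂⁆ ∈ hamSet act ω ∧ ω ξ₂ ξ₁ ∈ admSet act ω ∧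
        ∀ η, ω ⁅ξ₁, ξ₂⁆ η = act η (ω ξ₂ ξ₁)) := by
  have hlie : ∀ ξ, ξ ∈ hamSet act ω → ∀ a b, act ξ (ω a b) = ω ⁅ξ, a⁆ b + ω a ⁅ξ, b⁆ := by
    intro ξ h a b
    have := h.1.1 a b
    unfold lieD at this
    rw [sub_sub, sub_eq_zero] at this
    exact this
  have hrad : ∀ ξ, ξ ∈ radSet act ω ↔ ξ ∈ hamSet act ω ∧ ∀ η, ω ξ η = 0 := by
    intro ξ
    constructor
    · rintro ⟨h1, h2⟩
      refine ⟨⟨⟨fun a b => ?_, h2⟩, 0, fun η => by simp [h1]⟩, h1⟩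
      have := aux_cartan act ω hωalt ξ a b
      rw [h2] at this
      simpa [d1, h1] using this.symm
    · rintro ⟨h1, h2⟩
      exact ⟨h2, h1.1.2⟩
  refine ⟨?_, fun v hv => hv, hrad, ?_, ?_⟩
  · intro ξ hξ
    obtain ⟨v, hv⟩ := hξ.2
    exact ⟨v, ⟨ξ, hξ, fun η => (hv η).symm⟩, hv⟩
  · intro ξ ρ hξ hρ
    have h0 : ∀ η, ω ⁅ξ, ρ⁆ η = 0 := by
      intro η
      have := hlie ξ hξ ρ η
      simpa [hρ.1] using this.symm
    refine ⟨h0, fun a b => ?_⟩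
    rw [aux_cartan act ω hωalt,
      aux_lie act hact ω ξ ρ hξ.1.1 ((hrad ρ).1 hρ).1.1.1 a b]
    simp [d1, h0]
  · intro x y v w hx hy hv hw
    have h0 : ∀ η, ω ⁅x, y⁆ η = act η (ω y x) := by
      intro η
      have h := hlie x hx y η
      rw [← hw η, ← hw ⁅x, η⁆, hact, hw x] at h
      have h2 := eq_sub_of_add_eq h.symm
      rw [h2]
      abel
    have hL := aux_lie act hact ω x y hx.1.1 hy.1.1
    have hham : ⁅x, y⁆ ∈ hamSet act ω := by
      refine ⟨⟨hL, fun a b => ?_⟩, _, h0⟩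
      rw [aux_cartan act ω hωalt, hL]
      simp [d1, h0, hact]
    exact ⟨hham, ⟨_, hham, fun η => (h0 η).symm⟩, h0⟩
end

section
/- Let 𝔥_ω := {ξ ∈ 𝔥 : i_ξ(d_𝔥ω) = 0 and [ξ,ρ] ∈ rad(ω,d_𝔥ω) for all ρ ∈ rad(ω,d_𝔥ω)} (the normalizer of the radical). Then: (a) sp(𝔥,ω) ⊆ 𝔥_ω; (b) for ξ₁,ξ₁′,ξ₂,ξ₂′ ∈ 𝔥_ω with i_{ξ₁}ω = i_{ξ₁′}ω and i_{ξ₂}ω = i_{ξ₂′}ω one has i_{[ξ₁,ξ₂]}ω = i_{[ξ₁′,ξ₂′]}ω, so the bracket [i_{ξ₁}ω, i_{ξ₂}ω] := i_{[ξ₁,ξ₂]}ω on C¹(𝔥,V)_ω := {i_ξω : ξ ∈ 𝔥_ω} is well defined; (c) for all ξ₁,ξ₂ ∈ 𝔥 one has i_{[ξ₁,ξ₂]}ω = L_{ξ₁}(i_{ξ₂}ω) − i_{ξ₂}(L_{ξ₁}ω). -/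
/-!  Abstract hamiltonian setting: basic definitions.

`V` is an `𝔥`-module via the bilinear map `act`.  For `v : V`, the
1-cochain `d_𝔥 v` is the map `ξ ↦ act ξ v`, and for `ω` a 2-cochain,
`i_ξ ω = ω ξ`.  -/

variable {k : Type*} [Field k] [CharZero k]
variable {H : Type*} [LieRing H] [LieAlgebra k H]
variable {V : Type*} [AddCommGroup V] [Module k V]

/-- The normalizer `𝔥_ω` of the radical. -/
def nrmSet (act : H →ₗ[k] V →ₗ[k] V) (ω : H →ₗ[k] H →ₗ[k] V) : Set H :=
  {ξ | (∀ η ζ, d2 act ω ξ η ζ = 0) ∧ ∀ ρ ∈ radSet act ω, ⁅ξ, ρ⁆ ∈ radSet act ω}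

/-- Cartan-type identity: `L_ξ` commutes with the differential. -/
theorem d2_bracket_aux
    (act : H →ₗ[k] V →ₗ[k] V)
    (hact : ∀ (ξ η : H) (v : V), act ⁅ξ, η⁆ v = act ξ (act η v) - act η (act ξ v))
    (ω : H →ₗ[k] H →ₗ[k] V) (x a b c : H) :
    d2 act ω ⁅x, a⁆ b c = act x (d2 act ω a b c) - d2 act ω a ⁅x, b⁆ c - d2 act ω a b ⁅x, c⁆
      - (act a (lieD act ω x b c) - act b (lieD act ω x a c) + act c (lieD act ω x a b)
        - lieD act ω x ⁅a, b⁆ c + lieD act ω x ⁅a, c⁆ b - lieD act ω x ⁅b, c⁆ a) := by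
  simp only [d2, lieD, map_sub, map_add, LinearMap.add_apply, hact,
    leibniz_lie x a b, leibniz_lie x a c, leibniz_lie x b c]
  abel

theorem sub_mem_rad_aux
    (act : H →ₗ[k] V →ₗ[k] V) (ω : H →ₗ[k] H →ₗ[k] V) (x y : H)
    (hx : x ∈ nrmSet act ω) (hy : y ∈ nrmSet act ω) (h : ∀ η, ω x η = ω y η) :
    x - y ∈ radSet act ω := by
  refine ⟨fun η => by simp [h], fun η ζ => ?_⟩
  have e : d2 act ω (x - y) η ζ = d2 act ω x η ζ - d2 act ω y η ζ := by
    simp only [d2, map_sub, LinearMap.sub_apply, sub_lie]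
    abel
  rw [e, hx.1, hy.1, sub_zero]

/-- (a) `sp(𝔥,ω) ⊆ 𝔥_ω`; (b) the bracket on
`C¹(𝔥,V)_ω = {i_ξ ω : ξ ∈ 𝔥_ω}` is well defined; (c)
`i_{[ξ₁,ξ₂]} ω = L_{ξ₁}(i_{ξ₂} ω) − i_{ξ₂}(L_{ξ₁} ω)`. -/
theorem statement6
    (act : H →ₗ[k] V →ₗ[k] V)
    (hact : ∀ (ξ η : H) (v : V), act ⁅ξ, η⁆ v = act ξ (act η v) - act η (act ξ v))
    (ω : H →ₗ[k] H →ₗ[k] V) (hωalt : ∀ ξ, ω ξ ξ = 0) :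
    spSet act ω ⊆ nrmSet act ω ∧
    (∀ ξ₁ ξ₁' ξ₂ ξ₂' : H, ξ₁ ∈ nrmSet act ω → ξ₁' ∈ nrmSet act ω →
      ξ₂ ∈ nrmSet act ω → ξ₂' ∈ nrmSet act ω →
      (∀ η, ω ξ₁ η = ω ξ₁' η) → (∀ η, ω ξ₂ η = ω ξ₂' η) →
      ∀ η, ω ⁅ξ₁, ξ₂⁆ η = ω ⁅ξ₁', ξ₂'⁆ η) ∧
    (∀ ξ₁ ξ₂ η : H,
      ω ⁅ξ₁, ξ₂⁆ η = (act ξ₁ (ω ξ₂ η) - ω ξ₂ ⁅ξ₁, η⁆) - lieD act ω ξ₁ ξ₂ η) := by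
  refine ⟨?_, ?_, ?_⟩
  · rintro x ⟨hL, hd⟩
    refine ⟨hd, ?_⟩
    rintro r ⟨hr, hdr⟩
    refine ⟨fun η => ?_, fun η ζ => ?_⟩
    · have h := hL r η
      simpa [lieD, hr] using h
    · rw [d2_bracket_aux act hact]
      simp [hL, hdr]
  · intro x x' y y' hx hx' hy hy' h1 h2 η
    have r1 := (hy.2 _ (sub_mem_rad_aux act ω x x' hx hx' h1)).1 η
    have r2 := (hx'.2 _ (sub_mem_rad_aux act ω y y' hy hy' h2)).1 η
    have e : ⁅x, y⁆ = ⁅x', y'⁆ - ⁅y, x - x'⁆ + ⁅x', y - y'⁆ := by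
      simp only [lie_sub]
      rw [← lie_skew x y, ← lie_skew x' y]
      abel
    rw [e, map_add, map_sub, LinearMap.add_apply, LinearMap.sub_apply, r1, r2]
    simp
  · intro x y η
    simp only [lieD]
    abel
end

section
/- If η ∈ sp(𝔥,ω) and v ∈ V_ω, then η·v ∈ V_ω; more precisely, if d_𝔥v = i_ξω with ξ ∈ ham(𝔥,ω), then d_𝔥(η·v) = i_{[η,ξ]}ω and [η,ξ] ∈ ham(𝔥,ω). Moreover ω(ξ,η) ∈ V_ω for all ξ,η ∈ sp(𝔥,ω), so ω restricts to a V_ω-valued 2-cochain on sp(𝔥,ω). -/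
/-!  Abstract hamiltonian setting: basic definitions.

`V` is an `𝔥`-module via the bilinear map `act`.  For `v : V`, the
1-cochain `d_𝔥 v` is the map `ξ ↦ act ξ v`, and for `ω` a 2-cochain,
`i_ξ ω = ω ξ`.  -/

variable {k : Type*} [Field k] [CharZero k]
variable {H : Type*} [LieRing H] [LieAlgebra k H]
variable {V : Type*} [AddCommGroup V] [Module k V]

theorem aux_sp (act : H →ₗ[k] V →ₗ[k] V)
    (hact : ∀ (ξ η : H) (v : V), act ⁅ξ, η⁆ v = act ξ (act η v) - act η (act ξ v))
    (ω : H →ₗ[k] H →ₗ[k] V) {η ξ : H}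
    (hη : η ∈ spSet act ω) (hξ : ξ ∈ spSet act ω) : ⁅η, ξ⁆ ∈ spSet act ω := by
  -- invariance under `a`, as a rewriting rule
  have key : ∀ a, a ∈ spSet act ω → ∀ b c, act a (ω b c) = ω ⁅a, b⁆ c + ω b ⁅a, c⁆ := by
    intro a ha b c
    have h := ha.1 b c
    unfold lieD at h
    rw [sub_sub, sub_eq_zero] at h
    exact h
  have hL := key η hη
  have hM := key ξ hξ
  refine ⟨fun b c => ?_, fun b c => ?_⟩
  · unfold lieD
    rw [hact, hM, hL, map_add, map_add, hL, hL, hM, hM, lie_lie, lie_lie]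
    simp only [map_sub, LinearMap.sub_apply]
    abel
  · have h0 := congrArg (act η) (hξ.2 b c)
    have h1 := hξ.2 ⁅η, b⁆ c
    have h2 := hξ.2 b ⁅η, c⁆
    have comm : ∀ x v, act η (act x v) = act ⁅η, x⁆ v + act x (act η v) := by
      intro x v; rw [hact]; abel
    have : d2 act ω ⁅η, ξ⁆ b c = act η (d2 act ω ξ b c) - d2 act ω ξ ⁅η, b⁆ c
        - d2 act ω ξ b ⁅η, c⁆ := by
      unfold d2
      simp only [map_add, map_sub, comm, hL, lie_lie, LinearMap.sub_apply]
      abel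
    rw [this, hξ.2, h1, h2]; simp

/-- `V_ω` is an `sp(𝔥,ω)`-submodule of `V`, and `ω` restricts
to a `V_ω`-valued 2-cochain on `sp(𝔥,ω)`. -/
theorem statement7
    (act : H →ₗ[k] V →ₗ[k] V)
    (hact : ∀ (ξ η : H) (v : V), act ⁅ξ, η⁆ v = act ξ (act η v) - act η (act ξ v))
    (ω : H →ₗ[k] H →ₗ[k] V) (hωalt : ∀ ξ, ω ξ ξ = 0) :
    (∀ (η : H) (v : V) (ξ : H), η ∈ spSet act ω → ξ ∈ hamSet act ω →
      (∀ ζ, act ζ v = ω ξ ζ) →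
      ((∀ ζ, act ζ (act η v) = ω ⁅η, ξ⁆ ζ) ∧ ⁅η, ξ⁆ ∈ hamSet act ω ∧
        act η v ∈ admSet act ω)) ∧
    (∀ ξ η, ξ ∈ spSet act ω → η ∈ spSet act ω → ω ξ η ∈ admSet act ω) := by
  have first : ∀ (η : H) (v : V) (ξ : H), η ∈ spSet act ω →
      (∀ ζ, act ζ v = ω ξ ζ) → ∀ ζ, act ζ (act η v) = ω ⁅η, ξ⁆ ζ := by
    intro η v ξ hη hv ζ
    have h := hη.1 ξ ζ
    have h2 := hact η ζ v
    unfold lieD at h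
    rw [hv, hv ζ] at h2
    rw [h2] at h
    rw [← sub_eq_zero, ← h]
    abel
  refine ⟨fun η v ξ hη hξ hv => ?_, fun ξ η hξ hη => ?_⟩
  · have h1 := first η v ξ hη hv
    have h2 : ⁅η, ξ⁆ ∈ hamSet act ω :=
      ⟨aux_sp act hact ω hη hξ.1, act η v, fun ζ => (h1 ζ).symm⟩
    exact ⟨h1, h2, ⁅η, ξ⁆, h2, h1⟩
  · have h1 : ∀ ζ, act ζ (ω ξ η) = ω ⁅η, ξ⁆ ζ := by
      intro ζ
      have a := hξ.1 η ζ
      have b := hη.1 ξ ζ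
      have c := hξ.2 η ζ
      unfold lieD at a b
      unfold d2 at c
      rw [aux_skew ω hωalt ⁅ξ, ζ⁆ η, aux_skew ω hωalt ⁅η, ζ⁆ ξ] at c
      have e : act ζ (ω ξ η) - ω ⁅η, ξ⁆ ζ = (0 : V) - 0 + 0 := by
        nth_rewrite 1 [← c]
        nth_rewrite 1 [← a]
        rw [← b]
        abel
      rw [← sub_eq_zero, e]; simp
    exact ⟨⁅η, ξ⁆, ⟨aux_sp act hact ω hη hξ, ω ξ η, fun ζ => (h1 ζ).symm⟩, h1⟩
end

section
/- For all X,Y ∈ 𝔤 one has ζ(Y)·J(X) = ω(ζ(X),ζ(Y)), and consequently τ_J = d_𝔤J + ω_𝔤 as alternating bilinear maps 𝔤 × 𝔤 → V. Moreover τ_J(X,Y) ∈ V^𝔥 for all X,Y ∈ 𝔤. -/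
/-!  Abstract hamiltonian setting: basic definitions.

`V` is an `𝔥`-module via the bilinear map `act`.  For `v : V`, the
1-cochain `d_𝔥 v` is the map `ξ ↦ act ξ v`, and for `ω` a 2-cochain,
`i_ξ ω = ω ξ`.  -/

variable {k : Type*} [Field k] [CharZero k]
variable {H : Type*} [LieRing H] [LieAlgebra k H]
variable {V : Type*} [AddCommGroup V] [Module k V]

variable {Gg : Type*} [LieRing Gg] [LieAlgebra k Gg]

/-- `ζ(Y)·J(X) = ω(ζ(X),ζ(Y))`, hence `τ_J = d_𝔤 J + ω_𝔤`,
and `τ_J` takes values in `V^𝔥`. -/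
theorem statement11
    (act : H →ₗ[k] V →ₗ[k] V)
    (hact : ∀ (ξ η : H) (v : V), act ⁅ξ, η⁆ v = act ξ (act η v) - act η (act ξ v))
    (ω : H →ₗ[k] H →ₗ[k] V) (hωalt : ∀ ξ, ω ξ ξ = 0)
    (ζ : Gg →ₗ⁅k⁆ H) (hζ : ∀ X, ζ X ∈ hamSet act ω)
    (J : Gg →ₗ[k] V) (hJ : ∀ X η, act η (J X) = ω (ζ X) η) :
    (∀ X Y, act (ζ Y) (J X) = ω (ζ X) (ζ Y)) ∧
    (∀ X Y, act (ζ X) (J Y) - J ⁅X, Y⁆ =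
      (act (ζ X) (J Y) - act (ζ Y) (J X) - J ⁅X, Y⁆) + ω (ζ X) (ζ Y)) ∧
    (∀ X Y ξ, act ξ (act (ζ X) (J Y) - J ⁅X, Y⁆) = 0) := by
  refine ⟨fun X Y => hJ X (ζ Y), fun X Y => ?_, fun X Y ξ => ?_⟩
  · rw [hJ X (ζ Y)]
    abel
  · have h1 := hact ξ (ζ X) (J Y)
    have h2 := (hζ X).1.1 (ζ Y) ξ
    unfold lieD at h2
    have h3 : ω (ζ Y) ⁅ξ, ζ X⁆ = - ω (ζ Y) ⁅ζ X, ξ⁆ := by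
      rw [← lie_skew, map_neg]
    rw [hJ Y ⁅ξ, ζ X⁆, hJ Y ξ, h3] at h1
    rw [map_sub, hJ ⁅X, Y⁆ ξ, LieHom.map_lie]
    have h4 := eq_add_of_sub_eq h1.symm
    rw [h4, ← h2]
    abel
end

section
/- τ_J takes values in V^𝔥 and satisfies the cocycle identity τ_J([X,Y],Z) + τ_J([Y,Z],X) + τ_J([Z,X],Y) = 0 for all X,Y,Z ∈ 𝔤; hence ĝ := V^𝔥 × 𝔤 with bracket [(v,X),(w,Y)] := (τ_J(X,Y),[X,Y]) is a Lie algebra (a central extension of 𝔤 by V^𝔥). The map Ĵ : ĝ → V, Ĵ(v,X) := J(X) + v, is a momentum map for the homomorphism ζ̂ : ĝ → 𝔥, ζ̂(v,X) := ζ(X) (i.e. d_𝔥(Ĵ(v,X)) = i_{ζ(X)}ω), and Ĵ is equivariant: ζ(X)·Ĵ(w,Y) = Ĵ(τ_J(X,Y),[X,Y]) for all (v,X),(w,Y) ∈ ĝ. -/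
/-!  Abstract hamiltonian setting: basic definitions.

`V` is an `𝔥`-module via the bilinear map `act`.  For `v : V`, the
1-cochain `d_𝔥 v` is the map `ξ ↦ act ξ v`, and for `ω` a 2-cochain,
`i_ξ ω = ω ξ`.  -/

variable {k : Type*} [Field k] [CharZero k]
variable {H : Type*} [LieRing H] [LieAlgebra k H]
variable {V : Type*} [AddCommGroup V] [Module k V]

variable {Gg : Type*} [LieRing Gg] [LieAlgebra k Gg]

/-- The bracket of the central extension `ĝ = V^𝔥 ×_τ 𝔤`. -/
def brHat (tau : Gg → Gg → V) (p q : V × Gg) : V × Gg :=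
  (tau p.2 q.2, ⁅p.2, q.2⁆)

/-- `τ_J` is a `V^𝔥`-valued 2-cocycle, `ĝ = V^𝔥 ×_τ 𝔤` is a
Lie algebra, and `Ĵ(v,X) = J(X) + v` is an equivariant momentum map for
`ζ̂(v,X) = ζ(X)`. -/
theorem statement13
    (act : H →ₗ[k] V →ₗ[k] V)
    (hact : ∀ (ξ η : H) (v : V), act ⁅ξ, η⁆ v = act ξ (act η v) - act η (act ξ v))
    (ω : H →ₗ[k] H →ₗ[k] V) (hωalt : ∀ ξ, ω ξ ξ = 0)
    (ζ : Gg →ₗ⁅k⁆ H) (hζ : ∀ X, ζ X ∈ hamSet act ω)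
    (J : Gg →ₗ[k] V) (hJ : ∀ X η, act η (J X) = ω (ζ X) η)
    (tau : Gg → Gg → V)
    (htau : ∀ X Y, tau X Y = act (ζ X) (J Y) - J ⁅X, Y⁆) :
    -- τ_J takes values in V^𝔥
    (∀ X Y ξ, act ξ (tau X Y) = 0) ∧
    -- the cocycle identity
    (∀ X Y Z, tau ⁅X, Y⁆ Z + tau ⁅Y, Z⁆ X + tau ⁅Z, X⁆ Y = 0) ∧
    -- ĝ = V^𝔥 × 𝔤 with the bracket brHat is a Lie algebra
    (∀ (v w : V) (X Y : Gg), v ∈ invSet act → w ∈ invSet act →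
      (brHat tau (v, X) (w, Y)).1 ∈ invSet act) ∧
    (∀ p q r : V × Gg, brHat tau (p + q) r = brHat tau p r + brHat tau q r ∧
      brHat tau r (p + q) = brHat tau r p + brHat tau r q) ∧
    (∀ (a : k) (p q : V × Gg), brHat tau (a • p) q = a • brHat tau p q ∧
      brHat tau p (a • q) = a • brHat tau p q) ∧
    (∀ p : V × Gg, brHat tau p p = 0) ∧
    (∀ p q r : V × Gg,
      brHat tau (brHat tau p q) r + brHat tau (brHat tau q r) p +
        brHat tau (brHat tau r p) q = 0) ∧
    -- Ĵ is a momentum map for ζ̂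
    (∀ (v : V) (X : Gg), v ∈ invSet act →
      ∀ η, act η (J X + v) = ω (ζ X) η) ∧
    -- Ĵ is equivariant
    (∀ (X Y : Gg) (w : V), w ∈ invSet act →
      act (ζ X) (J Y + w) = J ⁅X, Y⁆ + tau X Y) := by
  have hjac : ∀ X Y Z : Gg, ⁅⁅X, Y⁆, Z⁆ + ⁅⁅Y, Z⁆, X⁆ + ⁅⁅Z, X⁆, Y⁆ = 0 := by
    intro X Y Z
    have h := lie_jacobi X Y Z
    rw [← lie_skew ⁅X, Y⁆ Z, ← lie_skew ⁅Y, Z⁆ X, ← lie_skew ⁅Z, X⁆ Y,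
      ← neg_add, ← neg_add, neg_eq_zero, ← h]
    abel
  have hskew : ∀ a b, ω a b = - ω b a := by
    intro a b
    have h := hωalt (a + b)
    simp only [map_add, LinearMap.add_apply, hωalt, zero_add, add_zero] at h
    rw [eq_neg_iff_add_eq_zero, add_comm]
    first | exact h | (rw [add_comm]; exact h)
  have ht : ∀ X Y, tau X Y = ω (ζ Y) (ζ X) - J ⁅X, Y⁆ := by
    intro X Y
    rw [htau, hJ]
  have h1 : ∀ X Y ξ, act ξ (tau X Y) = 0 := by
    intro X Y ξ
    have hL := (hζ X).1.1 (ζ Y) ξ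
    have ha := hact (ζ X) ξ (J Y)
    have hb := hJ ⁅X, Y⁆ ξ
    unfold lieD at hL
    rw [LieHom.map_lie] at hb
    rw [htau, map_sub, hb]
    rw [hJ Y ξ, hJ Y ⁅ζ X, ξ⁆] at ha
    rw [ha] at hL
    rw [← hL]
    abel
  have h2 : ∀ X Y Z, tau ⁅X, Y⁆ Z + tau ⁅Y, Z⁆ X + tau ⁅Z, X⁆ Y = 0 := by
    intro X Y Z
    have hX := (hζ X).1.1 (ζ Y) (ζ Z)
    have hY := (hζ Y).1.1 (ζ Z) (ζ X)
    have hZ := (hζ Z).1.1 (ζ X) (ζ Y)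
    have hd := (hζ X).1.2 (ζ Y) (ζ Z)
    have hj : J ⁅⁅X, Y⁆, Z⁆ + J ⁅⁅Y, Z⁆, X⁆ + J ⁅⁅Z, X⁆, Y⁆ = 0 := by
      rw [← map_add, ← map_add, hjac, map_zero]
    simp only [ht, LieHom.map_lie]
    unfold lieD at hX hY hZ
    unfold d2 at hd
    generalize ζ X = x at *
    generalize ζ Y = y at *
    generalize ζ Z = z at *
    rw [hskew y ⁅x, z⁆, ← lie_skew x z] at hX
    rw [hskew z ⁅y, x⁆, ← lie_skew y x] at hY
    rw [hskew x ⁅z, y⁆, ← lie_skew z y] at hZ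
    rw [hskew x z, ← lie_skew x z] at hd
    rw [hskew z, hskew x, hskew y]
    simp only [map_neg, LinearMap.neg_apply, neg_neg] at hX hY hZ hd
    linear_combination (norm := module) hX + hY + hZ - hd - hj
  refine ⟨h1, h2, fun v w X Y _ _ => h1 X Y, ?_, ?_, ?_, ?_, ?_, ?_⟩
  · intro p q r
    constructor <;> apply Prod.ext <;> simp [brHat, ht] <;> abel
  · intro a p q
    constructor <;> apply Prod.ext <;> simp [brHat, ht, smul_sub]
  · intro p
    apply Prod.ext <;> simp [brHat, ht, hωalt]
  · intro p q r
    apply Prod.ext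
    · exact h2 p.2 q.2 r.2
    · change ⁅⁅p.2, q.2⁆, r.2⁆ + ⁅⁅q.2, r.2⁆, p.2⁆ + ⁅⁅r.2, p.2⁆, q.2⁆ = 0
      exact hjac _ _ _
  · intro v X hv η
    rw [map_add, hv η, add_zero, hJ]
  · intro X Y w hw
    rw [map_add, hw, add_zero, htau]
    abel
end

section
/- Assume ω = d_𝔥α for some linear map α : 𝔥 → V, and let J be a momentum map for ζ. Set f_J := J + α∘ζ : 𝔤 → V. Then d_𝔥(f_J(X)) = L_{ζ(X)}α for every X ∈ 𝔤, and τ_J = d_𝔤f_J, i.e. τ_J(X,Y) = ζ(X)·f_J(Y) − ζ(Y)·f_J(X) − f_J([X,Y]) for all X,Y ∈ 𝔤. Moreover, for any linear map f : 𝔤 → V with d_𝔥(f(X)) = L_{ζ(X)}α for all X ∈ 𝔤, the map f − f_J takes values in V^𝔥. -/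
/-!  Abstract hamiltonian setting: basic definitions.

`V` is an `𝔥`-module via the bilinear map `act`.  For `v : V`, the
1-cochain `d_𝔥 v` is the map `ξ ↦ act ξ v`, and for `ω` a 2-cochain,
`i_ξ ω = ω ξ`.  -/

variable {k : Type*} [Field k] [CharZero k]
variable {H : Type*} [LieRing H] [LieAlgebra k H]
variable {V : Type*} [AddCommGroup V] [Module k V]

variable {Gg : Type*} [LieRing Gg] [LieAlgebra k Gg]

/-- If `ω = d_𝔥 α`, then `f_J := J + α ∘ ζ` satisfies
`d_𝔥(f_J(X)) = L_{ζ(X)} α` and `τ_J = d_𝔤 f_J`; any `f` with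
`d_𝔥(f(X)) = L_{ζ(X)} α` differs from `f_J` by a `V^𝔥`-valued map. -/
theorem statement14
    (act : H →ₗ[k] V →ₗ[k] V)
    (hact : ∀ (ξ η : H) (v : V), act ⁅ξ, η⁆ v = act ξ (act η v) - act η (act ξ v))
    (ω : H →ₗ[k] H →ₗ[k] V) (hωalt : ∀ ξ, ω ξ ξ = 0)
    (α : H →ₗ[k] V) (hωd : ∀ ξ η, ω ξ η = act ξ (α η) - act η (α ξ) - α ⁅ξ, η⁆)
    (ζ : Gg →ₗ⁅k⁆ H) (hζ : ∀ X, ζ X ∈ hamSet act ω)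
    (J : Gg →ₗ[k] V) (hJ : ∀ X η, act η (J X) = ω (ζ X) η) :
    -- d_𝔥 (f_J X) = L_{ζ X} α
    (∀ X η, act η (J X + α (ζ X)) = act (ζ X) (α η) - α ⁅ζ X, η⁆) ∧
    -- τ_J = d_𝔤 f_J
    (∀ X Y, act (ζ X) (J Y) - J ⁅X, Y⁆ =
      act (ζ X) (J Y + α (ζ Y)) - act (ζ Y) (J X + α (ζ X)) -
        (J ⁅X, Y⁆ + α (ζ ⁅X, Y⁆))) ∧
    -- (f − f_J) has values in V^𝔥
    (∀ f : Gg →ₗ[k] V,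
      (∀ X η, act η (f X) = act (ζ X) (α η) - α ⁅ζ X, η⁆) →
      ∀ X ξ, act ξ (f X - (J X + α (ζ X))) = 0) := by
  have h1 : ∀ X η, act η (J X + α (ζ X)) = act (ζ X) (α η) - α ⁅ζ X, η⁆ := by
    intro X η
    rw [map_add, hJ, hωd]
    abel
  refine ⟨h1, ?_, ?_⟩
  · intro X Y
    rw [h1 X (ζ Y), LieHom.map_lie, map_add]
    abel
  · intro f hf X ξ
    rw [map_sub, hf, h1, sub_self]
end

section
/- Assume additionally that g·ω_𝔤(X,Y) = ω_𝔤(Ad(g)X, Ad(g)Y) for all g ∈ G, X,Y ∈ 𝔤, where ω_𝔤(X,Y) := ω(ζ(X),ζ(Y)), and that τ_J takes values in V^𝔥 and ĝ := V^𝔥 × 𝔤 with bracket [(v,X),(w,Y)] := (τ_J(X,Y),[X,Y]) is a Lie algebra. Then: (a) g·(τ_J(Ad(g)⁻¹X, Ad(g)⁻¹Y)) − τ_J(X,Y) = −κ(g)([X,Y]) for all g ∈ G, X,Y ∈ 𝔤; (b) for each g ∈ G the map Âd(g)(v,X) := (v + κ(g)(Ad(g)X), Ad(g)X) is a Lie algebra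 automorphism of ĝ; (c) Âd(g₁g₂) = Âd(g₁)∘Âd(g₂) for all g₁,g₂ ∈ G; (d) κ(g)(Ad(g)X) = −κ(g⁻¹)(X) for all g ∈ G, X ∈ 𝔤; (e) the map Ĵ(v,X) := J(X) + v satisfies Ĵ(Âd(g)(v,X)) = g·Ĵ(v,X) for all g ∈ G and (v,X) ∈ ĝ. -/
/-!  Abstract hamiltonian setting: basic definitions.

`V` is an `𝔥`-module via the bilinear map `act`.  For `v : V`, the
1-cochain `d_𝔥 v` is the map `ξ ↦ act ξ v`, and for `ω` a 2-cochain,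
`i_ξ ω = ω ξ`.  -/

variable {k : Type*} [Field k] [CharZero k]
variable {H : Type*} [LieRing H] [LieAlgebra k H]
variable {V : Type*} [AddCommGroup V] [Module k V]

variable {Gg : Type*} [LieRing Gg] [LieAlgebra k Gg]

/-- The adjoint action of `G` on `ĝ = V^𝔥 ×_τ 𝔤`:
`Âd(g)(v,X) = (v + κ(g)(Ad(g)X), Ad(g)X)` is an action by Lie algebra
automorphisms, and `Ĵ(v,X) = J(X) + v` is `G`-equivariant. -/
theorem statement16
    (act : H →ₗ[k] V →ₗ[k] V)
    (hact : ∀ (ξ η : H) (v : V), act ⁅ξ, η⁆ v = act ξ (act η v) - act η (act ξ v))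
    (ω : H →ₗ[k] H →ₗ[k] V) (hωalt : ∀ ξ, ω ξ ξ = 0)
    (ζ : Gg →ₗ⁅k⁆ H) (hζ : ∀ X, ζ X ∈ hamSet act ω)
    (J : Gg →ₗ[k] V) (hJ : ∀ X η, act η (J X) = ω (ζ X) η)
    {G : Type*} [Group G]
    (ρ : G →* Module.End k V)
    (Ad : G → Gg →ₗ⁅k⁆ Gg)
    (hAdone : ∀ X, Ad 1 X = X)
    (hAdmul : ∀ g₁ g₂ X, Ad (g₁ * g₂) X = Ad g₁ (Ad g₂ X))
    (hcompat : ∀ (g : G) (X : Gg) (v : V),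
      ρ g (act (ζ X) v) = act (ζ (Ad g X)) (ρ g v))
    (hfix : ∀ (g : G) (v : V), (∀ ξ, act ξ v = 0) → ρ g v = v)
    (kap : G → Gg → V)
    (hkap : ∀ g X, kap g X = ρ g (J (Ad g⁻¹ X)) - J X)
    (hkapval : ∀ g X ξ, act ξ (kap g X) = 0)
    -- ω_𝔤 is G-invariant
    (hinvom : ∀ (g : G) (X Y : Gg),
      ρ g (ω (ζ X) (ζ Y)) = ω (ζ (Ad g X)) (ζ (Ad g Y)))
    -- τ_J takes values in V^𝔥 and ĝ = V^𝔥 ×_τ 𝔤 is a Lie algebra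
    (tau : Gg → Gg → V)
    (htau : ∀ X Y, tau X Y = act (ζ X) (J Y) - J ⁅X, Y⁆)
    (htauval : ∀ X Y ξ, act ξ (tau X Y) = 0)
    (htaucoc : ∀ X Y Z, tau ⁅X, Y⁆ Z + tau ⁅Y, Z⁆ X + tau ⁅Z, X⁆ Y = 0)
    (Adh : G → V × Gg → V × Gg)
    (hAdh : ∀ (g : G) (p : V × Gg), Adh g p = (p.1 + kap g (Ad g p.2), Ad g p.2)) :
    -- (a) g·(τ_J ∘ (Ad g⁻¹ × Ad g⁻¹)) − τ_J = −κ(g)∘[·,·]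
    (∀ (g : G) (X Y : Gg),
      ρ g (tau (Ad g⁻¹ X) (Ad g⁻¹ Y)) - tau X Y = - kap g ⁅X, Y⁆) ∧
    -- (b) Âd(g) is a Lie algebra automorphism of ĝ
    (∀ (g : G) (p q : V × Gg), Adh g (p + q) = Adh g p + Adh g q) ∧
    (∀ (g : G) (a : k) (p : V × Gg), Adh g (a • p) = a • Adh g p) ∧
    (∀ (g : G) (p q : V × Gg),
      Adh g (tau p.2 q.2, ⁅p.2, q.2⁆) =
        (tau (Adh g p).2 (Adh g q).2, ⁅(Adh g p).2, (Adh g q).2⁆)) ∧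
    (∀ (g : G) (p : V × Gg), (∀ ξ, act ξ p.1 = 0) →
      ∀ ξ, act ξ (Adh g p).1 = 0) ∧
    -- (c) Âd is an action
    (∀ (g₁ g₂ : G) (p : V × Gg), Adh (g₁ * g₂) p = Adh g₁ (Adh g₂ p)) ∧
    -- (d) κ(g)(Ad(g)X) = −κ(g⁻¹)(X)
    (∀ (g : G) (X : Gg), kap g (Ad g X) = - kap g⁻¹ X) ∧
    -- (e) Ĵ is G-equivariant
    (∀ (g : G) (p : V × Gg), (∀ ξ, act ξ p.1 = 0) →
      J (Adh g p).2 + (Adh g p).1 = ρ g (J p.2 + p.1)) := by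
  have hl : ∀ g X, Ad g⁻¹ (Ad g X) = X := fun g X => by
    rw [← hAdmul, inv_mul_cancel, hAdone]
  have hr : ∀ g X, Ad g (Ad g⁻¹ X) = X := fun g X => by
    rw [← hAdmul, mul_inv_cancel, hAdone]
  have hK : ∀ g X, kap g (Ad g X) = ρ g (J X) - J (Ad g X) := fun g X => by
    rw [hkap, hl]
  have hρ : ∀ g v, ρ g (ρ g⁻¹ v) = v := fun g v => by
    rw [← Module.End.mul_apply, ← map_mul, mul_inv_cancel, map_one, Module.End.one_apply]
  have hT : ∀ g X Y, ρ g (tau X Y) = ω (ζ (Ad g Y)) (ζ (Ad g X)) - ρ g (J ⁅X, Y⁆) :=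
    fun g X Y => by rw [htau, hJ, map_sub, hinvom]
  refine ⟨?_, ?_, ?_, ?_, ?_, ?_, ?_, ?_⟩
  · intro g X Y
    rw [hT, hr, hr, htau, hJ, hkap, LieHom.map_lie]
    abel
  · intro g p q
    simp only [hAdh, hK]
    simp only [Prod.fst_add, Prod.snd_add, map_add, Prod.mk_add_mk]
    congr 1
    abel
  · intro g a p
    simp only [hAdh, hK]
    simp only [Prod.smul_fst, Prod.smul_snd, map_smul, Prod.smul_mk, smul_add,
      smul_sub]
  · intro g p q
    simp only [hAdh, hK]
    simp only [LieHom.map_lie]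
    congr 1
    rw [← hfix g (tau p.2 q.2) (htauval _ _), hT, htau, hJ]
    abel
  · intro g p hp ξ
    rw [hAdh]
    simp only [map_add, hp, hkapval, add_zero]
  · intro g₁ g₂ p
    have h := hfix g₁ _ (hkapval g₂ (Ad g₂ p.2))
    simp only [hAdh, hAdmul]
    congr 1
    rw [add_assoc, ← h, ← hAdmul, hK, hK, hAdmul, hK, map_mul, Module.End.mul_apply, map_sub]
    abel
  · intro g X
    rw [← hfix g _ (hkapval g⁻¹ X), hK, hkap, inv_inv, map_sub, hρ]
    abel
  · intro g p hp
    rw [hAdh, map_add, hfix g p.1 hp]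
    simp only [hK]
    abel
end

section
/- If ξ ∈ ham(𝔥,ω) and v ∈ V^𝔤 := {w ∈ V : ζ(X)·w = 0 for all X ∈ 𝔤} satisfy i_ξω = d_𝔥v, then ξ·J(X) = 0 for all X ∈ 𝔤. -/
/-!  Abstract hamiltonian setting: basic definitions.

`V` is an `𝔥`-module via the bilinear map `act`.  For `v : V`, the
1-cochain `d_𝔥 v` is the map `ξ ↦ act ξ v`, and for `ω` a 2-cochain,
`i_ξ ω = ω ξ`.  -/

variable {k : Type*} [Field k] [CharZero k]
variable {H : Type*} [LieRing H] [LieAlgebra k H]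
variable {V : Type*} [AddCommGroup V] [Module k V]

variable {Gg : Type*} [LieRing Gg] [LieAlgebra k Gg]

/-- (Noether) If `ξ ∈ ham(𝔥,ω)` has a `𝔤`-invariant
hamiltonian `v`, then `ξ·J(X) = 0` for all `X ∈ 𝔤`. -/
theorem statement17
    (act : H →ₗ[k] V →ₗ[k] V)
    (hact : ∀ (ξ η : H) (v : V), act ⁅ξ, η⁆ v = act ξ (act η v) - act η (act ξ v))
    (ω : H →ₗ[k] H →ₗ[k] V) (hωalt : ∀ ξ, ω ξ ξ = 0)
    (ζ : Gg →ₗ⁅k⁆ H) (hζ : ∀ X, ζ X ∈ hamSet act ω)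
    (J : Gg →ₗ[k] V) (hJ : ∀ X η, act η (J X) = ω (ζ X) η)
    (ξ : H) (hξ : ξ ∈ hamSet act ω) (v : V)
    (hvinv : ∀ X : Gg, act (ζ X) v = 0)
    (hdv : ∀ η, ω ξ η = act η v) :
    ∀ X : Gg, act ξ (J X) = 0 := by
  intro X
  have h := hωalt (ζ X + ξ)
  simp only [map_add, LinearMap.add_apply, hωalt, zero_add, add_zero] at h
  rw [hdv, hvinv] at h
  rw [hJ]
  simpa using h
end

section
/- If ζ₁(X₁)·J₂(X₂) = 0 for all X₁ ∈ 𝔤₁ and X₂ ∈ 𝔤₂, then ζ₂(X₂)·J₁(X₁) = 0 for all X₁ ∈ 𝔤₁, X₂ ∈ 𝔤₂, and moreover [ζ₁(X₁), ζ₂(X₂)] ∈ rad ω := {ξ ∈ 𝔥 : i_ξω = 0} for all X₁ ∈ 𝔤₁, X₂ ∈ 𝔤₂. -/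
/-!  Abstract hamiltonian setting: basic definitions.

`V` is an `𝔥`-module via the bilinear map `act`.  For `v : V`, the
1-cochain `d_𝔥 v` is the map `ξ ↦ act ξ v`, and for `ω` a 2-cochain,
`i_ξ ω = ω ξ`.  -/

variable {k : Type*} [Field k] [CharZero k]
variable {H : Type*} [LieRing H] [LieAlgebra k H]
variable {V : Type*} [AddCommGroup V] [Module k V]

variable {Gg₁ : Type*} [LieRing Gg₁] [LieAlgebra k Gg₁]
variable {Gg₂ : Type*} [LieRing Gg₂] [LieAlgebra k Gg₂]

/-- (Marsden–Weinstein type) If `J₂` is `𝔤₁`-invariant then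
`J₁` is `𝔤₂`-invariant and `[ζ₁(𝔤₁), ζ₂(𝔤₂)] ⊆ rad ω`. -/
theorem statement18
    (act : H →ₗ[k] V →ₗ[k] V)
    (hact : ∀ (ξ η : H) (v : V), act ⁅ξ, η⁆ v = act ξ (act η v) - act η (act ξ v))
    (ω : H →ₗ[k] H →ₗ[k] V) (hωalt : ∀ ξ, ω ξ ξ = 0)
    (ζ₁ : Gg₁ →ₗ⁅k⁆ H) (hζ₁ : ∀ X, ζ₁ X ∈ hamSet act ω)
    (ζ₂ : Gg₂ →ₗ⁅k⁆ H) (hζ₂ : ∀ X, ζ₂ X ∈ hamSet act ω)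
    (J₁ : Gg₁ →ₗ[k] V) (hJ₁ : ∀ X η, act η (J₁ X) = ω (ζ₁ X) η)
    (J₂ : Gg₂ →ₗ[k] V) (hJ₂ : ∀ X η, act η (J₂ X) = ω (ζ₂ X) η)
    (hinv : ∀ (X₁ : Gg₁) (X₂ : Gg₂), act (ζ₁ X₁) (J₂ X₂) = 0) :
    (∀ (X₁ : Gg₁) (X₂ : Gg₂), act (ζ₂ X₂) (J₁ X₁) = 0) ∧
    (∀ (X₁ : Gg₁) (X₂ : Gg₂) (η : H), ω ⁅ζ₁ X₁, ζ₂ X₂⁆ η = 0) := by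
  refine ⟨fun X₁ X₂ => ?_, fun X₁ X₂ η => ?_⟩
  · have h := hωalt (ζ₁ X₁ + ζ₂ X₂)
    simp only [map_add, LinearMap.add_apply, hωalt, zero_add, add_zero] at h
    rw [← hJ₂, ← hJ₁, hinv] at h
    simpa using h
  · have h := (hζ₁ X₁).1.1 (ζ₂ X₂) η
    unfold lieD at h
    rw [← hJ₂, ← hJ₂, hact, hinv, map_zero, sub_zero] at h
    simpa using h
end
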